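/- The q-Gauss summation formula: for complex numbers q, a, b, c with |q| < 1, a ≠ 0, b ≠ 0, |c/(ab)| < 1, and c ∉ {q^{−m} : m ∈ ℕ} (so that (c;q)_k ≠ 0 for all k), one has ∑_{k=0}^∞ ((a;q)_k (b;q)_k / ((c;q)_k (q;q)_k)) (c/(ab))^k = ((c/a;q)_∞ (c/b;q)_∞) / ((c;q)_∞ (c/(ab);q)_∞). -/

import Mathlib

/-- The finite `q`-shifted factorial `(a;q)_k`. -/
noncomputable def qPoch (a q : ℂ) (k : ℕ) : ℂ := ∏ j ∈ Finset.range k, (1 - a * q ^ j)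

/-- The infinite `q`-shifted factorial `(a;q)_∞`. -/
noncomputable def qPochInf (a q : ℂ) : ℂ := ∏' j : ℕ, (1 - a * q ^ j)

open Filter Topology

theorem qPoch_zero (a q : ℂ) : qPoch a q 0 = 1 := by simp [qPoch]

theorem qPoch_succ (a q : ℂ) (k : ℕ) :
    qPoch a q (k + 1) = qPoch a q k * (1 - a * q ^ k) := by
  simp [qPoch, Finset.prod_range_succ]

theorem qPoch_add (a q : ℂ) (n k : ℕ) :
    qPoch a q (n + k) = qPoch a q n * qPoch (a * q ^ n) q k := by
  simp [qPoch, Finset.prod_range_add, pow_add, mul_assoc]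

theorem one_sub_mul_qPoch_mul (a q : ℂ) (k : ℕ) :
    (1 - a) * qPoch (a * q) q k = qPoch a q k * (1 - a * q ^ k) := by
  rw [← qPoch_succ, add_comm k 1, qPoch_add]
  simp [qPoch]

theorem qPoch_ne_zero {a q : ℂ} (h : ∀ m : ℕ, a * q ^ m ≠ 1) (k : ℕ) : qPoch a q k ≠ 0 :=
  Finset.prod_ne_zero_iff.2 fun j _ => sub_ne_zero.2 (h j).symm

theorem mul_pow_ne_one_of_norm_lt_one {a q : ℂ} (ha : ‖a‖ < 1) (hq : ‖q‖ < 1) (m : ℕ) :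
    a * q ^ m ≠ 1 := by
  intro h
  have h1 : ‖a‖ * ‖q‖ ^ m = 1 := by rw [← norm_pow, ← norm_mul, h, norm_one]
  have h2 : ‖q‖ ^ m ≤ 1 := pow_le_one₀ (norm_nonneg q) hq.le
  nlinarith [norm_nonneg a]

theorem summable_norm_neg_mul_pow (a : ℂ) {q : ℂ} (hq : ‖q‖ < 1) :
    Summable fun j : ℕ => ‖-(a * q ^ j)‖ := by
  simpa using (summable_geometric_of_lt_one (norm_nonneg q) hq).mul_left ‖a‖

theorem tendsto_qPoch (a : ℂ) {q : ℂ} (hq : ‖q‖ < 1) :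
    Tendsto (qPoch a q) atTop (𝓝 (qPochInf a q)) := by
  have h := multipliable_one_add_of_summable (summable_norm_neg_mul_pow a hq)
  simp only [← sub_eq_add_neg] at h
  exact h.tendsto_prod_tprod_nat

theorem qPochInf_ne_zero {a q : ℂ} (hq : ‖q‖ < 1) (h : ∀ m : ℕ, a * q ^ m ≠ 1) :
    qPochInf a q ≠ 0 := by
  have := tprod_one_add_ne_zero_of_summable (f := fun j : ℕ => -(a * q ^ j))
    (fun j => by simpa only [← sub_eq_add_neg] using sub_ne_zero.2 (h j).symm)
    (summable_norm_neg_mul_pow a hq)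
  simpa only [qPochInf, ← sub_eq_add_neg] using this

theorem exists_norm_qPoch_le (a : ℂ) {q : ℂ} (hq : ‖q‖ < 1) :
    ∃ M, ∀ k, ‖qPoch a q k‖ ≤ M := by
  obtain ⟨M, hM⟩ := (tendsto_qPoch a hq).norm.bddAbove_range
  exact ⟨M, fun k => hM ⟨k, rfl⟩⟩

theorem exists_norm_inv_qPoch_le {a q : ℂ} (hq : ‖q‖ < 1) (h : ∀ m : ℕ, a * q ^ m ≠ 1) :
    ∃ M, ∀ k, ‖(qPoch a q k)⁻¹‖ ≤ M := by
  obtain ⟨M, hM⟩ := ((tendsto_qPoch a hq).inv₀ (qPochInf_ne_zero hq h)).norm.bddAbove_range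
  exact ⟨M, fun k => hM ⟨k, rfl⟩⟩

/-- The general term of the `q`-Gauss series. -/
noncomputable def qGaussTerm (a b c q : ℂ) (k : ℕ) : ℂ :=
  qPoch a q k * qPoch b q k / (qPoch c q k * qPoch q q k) * (c / (a * b)) ^ k

/-- The shifts `c ↦ c q ^ n` of the `q`-Gauss series are dominated by geometric series with a
common constant. -/
theorem exists_norm_qGaussTerm_le (a b : ℂ) {c q : ℂ} (hq : ‖q‖ < 1)
    (hc : ∀ m : ℕ, c * q ^ m ≠ 1) :
    ∃ M, ∀ n k, ‖qGaussTerm a b (c * q ^ n) q k‖ ≤ M * (‖c / (a * b)‖ * ‖q‖ ^ n) ^ k := by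
  obtain ⟨A, hA⟩ := exists_norm_qPoch_le a hq
  obtain ⟨B, hB⟩ := exists_norm_qPoch_le b hq
  obtain ⟨C, hC⟩ := exists_norm_qPoch_le c hq
  obtain ⟨D, hD⟩ := exists_norm_inv_qPoch_le hq hc
  obtain ⟨E, hE⟩ := exists_norm_inv_qPoch_le hq (mul_pow_ne_one_of_norm_lt_one hq hq)
  have hA0 := (norm_nonneg _).trans (hA 0)
  have hB0 := (norm_nonneg _).trans (hB 0)
  have hC0 := (norm_nonneg _).trans (hC 0)
  have hD0 := (norm_nonneg _).trans (hD 0)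
  refine ⟨A * B * (C * D * E), fun n k => ?_⟩
  have hterm : qGaussTerm a b (c * q ^ n) q k =
      qPoch a q k * qPoch b q k *
        (qPoch c q n * (qPoch c q (n + k))⁻¹ * (qPoch q q k)⁻¹) *
          (c / (a * b) * q ^ n) ^ k := by
    have := qPoch_ne_zero hc n
    rw [qGaussTerm, qPoch_add, mul_inv, mul_inv_cancel_left₀ this, ← mul_inv, div_eq_mul_inv,
      div_mul_eq_mul_div c]
  rw [hterm]
  simp only [norm_mul, norm_pow]
  gcongr
  exacts [hA k, hB k, hC n, hD _, hE k]

theorem summable_qGaussTerm {a b c q : ℂ} (hq : ‖q‖ < 1) (hz : ‖c / (a * b)‖ < 1)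
    (hc : ∀ m : ℕ, c * q ^ m ≠ 1) : Summable (qGaussTerm a b c q) := by
  obtain ⟨M, hM⟩ := exists_norm_qGaussTerm_le a b hq hc
  refine .of_norm_bounded ((summable_geometric_of_lt_one (norm_nonneg _) hz).mul_left M)
    fun k => ?_
  simpa using hM 0 k

/-- The telescoping certificate for the contiguous relation `c ↦ c q`. -/
theorem qGaussTerm_telescope {a b c q : ℂ} (hq : ‖q‖ < 1) (ha : a ≠ 0) (hb : b ≠ 0)
    (hc : ∀ m : ℕ, c * q ^ m ≠ 1) (k : ℕ) :
    (1 - c) * (1 - c / (a * b)) * qGaussTerm a b c q k -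
        (1 - c / a) * (1 - c / b) * qGaussTerm a b (c * q) q k =
      (1 - c) * ((1 - q ^ k) * qGaussTerm a b c q k -
        (1 - q ^ (k + 1)) * qGaussTerm a b c q (k + 1)) := by
  have h1 : 1 - c ≠ 0 := by simpa using sub_ne_zero.2 (hc 0).symm
  have h2 : 1 - c * q ^ k ≠ 0 := sub_ne_zero.2 (hc k).symm
  have hq' := mul_pow_ne_one_of_norm_lt_one hq hq
  have h3 : 1 - q ^ k * q ≠ 0 := sub_ne_zero.2 (mul_comm q _ ▸ (hq' k).symm)
  have h4 := qPoch_ne_zero hc k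
  have h5 := qPoch_ne_zero hq' k
  have hshift : qGaussTerm a b (c * q) q k =
      qGaussTerm a b c q k * (q ^ k * (1 - c) / (1 - c * q ^ k)) := by
    have h : qPoch (c * q) q k = qPoch c q k * (1 - c * q ^ k) / (1 - c) := by
      rw [← one_sub_mul_qPoch_mul, mul_div_cancel_left₀ _ h1]
    rw [qGaussTerm, qGaussTerm, h, mul_div_right_comm c q, mul_pow]
    field_simp
  have hsucc : qGaussTerm a b c q (k + 1) = qGaussTerm a b c q k *
      ((1 - a * q ^ k) * (1 - b * q ^ k) / ((1 - c * q ^ k) * (1 - q ^ k * q)) *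
        (c / (a * b))) := by
    simp only [qGaussTerm, qPoch_succ, pow_succ (c / (a * b)), mul_comm q]
    field_simp
  rw [hshift, hsucc, pow_succ q]
  generalize qGaussTerm a b c q k = t
  generalize q ^ k = x at *
  field_simp
  ring

theorem tsum_qGaussTerm_contiguous {a b c q : ℂ} (hq : ‖q‖ < 1) (ha : a ≠ 0) (hb : b ≠ 0)
    (hz : ‖c / (a * b)‖ < 1) (hc : ∀ m : ℕ, c * q ^ m ≠ 1) :
    (1 - c) * (1 - c / (a * b)) * ∑' k, qGaussTerm a b c q k =
      (1 - c / a) * (1 - c / b) * ∑' k, qGaussTerm a b (c * q) q k := by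
  have hs := summable_qGaussTerm hq hz hc
  have hz' : ‖c * q / (a * b)‖ < 1 := by
    rw [mul_div_right_comm, norm_mul]
    exact mul_lt_one_of_nonneg_of_lt_one_left (norm_nonneg _) hz hq.le
  have hs' : Summable (qGaussTerm a b (c * q) q) :=
    summable_qGaussTerm hq hz' fun m => by simpa [pow_succ', mul_assoc] using hc (m + 1)
  have hsum := ((hs.hasSum.mul_left ((1 - c) * (1 - c / (a * b)))).sub
    (hs'.hasSum.mul_left ((1 - c / a) * (1 - c / b)))).tendsto_sum_nat
  have hpow : Tendsto (fun n => 1 - q ^ n) atTop (𝓝 (1 - 0)) :=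
    (tendsto_pow_atTop_nhds_zero_of_norm_lt_one hq).const_sub 1
  have hlim := ((hpow.mul hs.tendsto_atTop_zero).const_sub 0).const_mul (1 - c)
  refine sub_eq_zero.1 (tendsto_nhds_unique hsum ?_)
  convert hlim using 2 with n
  · simp only [qGaussTerm_telescope hq ha hb hc, ← Finset.mul_sum]
    rw [Finset.sum_range_sub' fun k => (1 - q ^ k) * qGaussTerm a b c q k]
    simp
  · simp

theorem tsum_qGaussTerm_iterate {a b c q : ℂ} (hq : ‖q‖ < 1) (ha : a ≠ 0) (hb : b ≠ 0)
    (hz : ‖c / (a * b)‖ < 1) (hc : ∀ m : ℕ, c * q ^ m ≠ 1) (n : ℕ) :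
    qPoch c q n * qPoch (c / (a * b)) q n * ∑' k, qGaussTerm a b c q k =
      qPoch (c / a) q n * qPoch (c / b) q n * ∑' k, qGaussTerm a b (c * q ^ n) q k := by
  induction n with
  | zero => simp [qPoch_zero]
  | succ n ih =>
    have hz' : ‖c * q ^ n / (a * b)‖ < 1 := by
      rw [mul_div_right_comm, norm_mul, norm_pow]
      exact mul_lt_one_of_nonneg_of_lt_one_left (norm_nonneg _) hz
        (pow_le_one₀ (norm_nonneg q) hq.le)
    have h := tsum_qGaussTerm_contiguous hq ha hb hz' fun m => by
      simpa [pow_add, mul_assoc] using hc (n + m)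
    rw [mul_assoc c, ← pow_succ] at h
    simp only [mul_div_right_comm c (q ^ n)] at h
    simp only [qPoch_succ]
    linear_combination (1 - c * q ^ n) * (1 - c / (a * b) * q ^ n) * ih +
      qPoch (c / a) q n * qPoch (c / b) q n * h

theorem tendsto_tsum_qGaussTerm {a b c q : ℂ} (hq : ‖q‖ < 1)
    (hz : ‖c / (a * b)‖ < 1) (hc : ∀ m : ℕ, c * q ^ m ≠ 1) :
    Tendsto (fun n : ℕ => ∑' k, qGaussTerm a b (c * q ^ n) q k) atTop (𝓝 1) := by
  obtain ⟨M, hM⟩ := exists_norm_qGaussTerm_le a b hq hc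
  have hM0 : 0 ≤ M := by simpa using (norm_nonneg _).trans (hM 0 0)
  have hlim : Tendsto (fun n : ℕ => ∑' k, qGaussTerm a b (c * q ^ n) q k) atTop
      (𝓝 (∑' k, if k = 0 then (1 : ℂ) else 0)) := by
    refine tendsto_tsum_of_dominated_convergence
      ((summable_geometric_of_lt_one (norm_nonneg _) hz).mul_left M) (fun k => ?_)
      (.of_forall fun n k => (hM n k).trans ?_)
    · rcases eq_or_ne k 0 with rfl | hk
      · simp [qGaussTerm, qPoch_zero]
      · rw [if_neg hk]
        refine squeeze_zero_norm (fun n => hM n k) ?_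
        have h := (((tendsto_pow_atTop_nhds_zero_of_lt_one (norm_nonneg q) hq).const_mul
          ‖c / (a * b)‖).pow k).const_mul M
        simpa [hk] using h
    · gcongr
      exact mul_le_of_le_one_right (norm_nonneg _) (pow_le_one₀ (norm_nonneg q) hq.le)
  simpa using hlim

/-- The `q`-Gauss summation formula:
`∑_{k=0}^∞ ((a;q)_k (b;q)_k / ((c;q)_k (q;q)_k)) (c/(ab))^k
  = ((c/a;q)_∞ (c/b;q)_∞) / ((c;q)_∞ (c/(ab);q)_∞)`,
for `‖q‖ < 1`, `a ≠ 0`, `b ≠ 0`, `‖c/(ab)‖ < 1`, and `c ∉ {q^{−m} : m ∈ ℕ}`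
(the latter expressed as `c * q ^ m ≠ 1` for all `m : ℕ`). -/
theorem q_gauss_summation (q a b c : ℂ) (hq : ‖q‖ < 1) (ha : a ≠ 0) (hb : b ≠ 0)
    (hz : ‖c / (a * b)‖ < 1) (hc : ∀ m : ℕ, c * q ^ m ≠ 1) :
    HasSum (fun k : ℕ =>
        qPoch a q k * qPoch b q k / (qPoch c q k * qPoch q q k) * (c / (a * b)) ^ k)
      (qPochInf (c / a) q * qPochInf (c / b) q /
        (qPochInf c q * qPochInf (c / (a * b)) q)) := by
  have hlim := ((tendsto_qPoch (c / a) hq).mul (tendsto_qPoch (c / b) hq)).mul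
    (tendsto_tsum_qGaussTerm hq hz hc)
  have hlim' := ((tendsto_qPoch c hq).mul (tendsto_qPoch (c / (a * b)) hq)).mul_const
    (∑' k, qGaussTerm a b c q k)
  have heq := tendsto_nhds_unique hlim'
    (hlim.congr fun n => (tsum_qGaussTerm_iterate hq ha hb hz hc n).symm)
  have hne : qPochInf c q * qPochInf (c / (a * b)) q ≠ 0 :=
    mul_ne_zero (qPochInf_ne_zero hq hc)
      (qPochInf_ne_zero hq (mul_pow_ne_one_of_norm_lt_one hz hq))
  rw [mul_one, mul_comm] at heq
  rw [← eq_div_of_mul_eq hne heq]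
  exact (summable_qGaussTerm hq hz hc).hasSum
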